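/- arXiv:1505.00144 — 8 statements merged into one kernel-verified Lean document; each statement's English description precedes it below -/
import Mathlib

section
/- Let M = {A_1, ..., A_m} be a finite set of n×n row-stochastic real matrices. There exists a switching sequence σ : ℕ → {1,...,m} such that for every initial vector x_0 ∈ ℝ^n the trajectory x(t+1) = A_{σ(t)} x(t), x(0) = x_0, converges to a consensus vector (a vector all of whose entries are equal, with the common value possibly depending on x_0) if and only if M is column-primitive, i.e., there exists a finite word w = w_l ... w_1 over {1,...,m} such that the product A_{w_l} ⋯ A_{w_1} has a column all of whose entries are strictly positive. -/
open Matrix Filter Topology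

/-- The word `σ (s + t - 1), …, σ s` of the letters read during `t` steps from time `s`, the
last one first. -/
def switchingWord {m : ℕ} (σ : ℕ → Fin m) (s t : ℕ) : List (Fin m) :=
  ((List.range t).map fun i => σ (s + i)).reverse

lemma length_switchingWord {m : ℕ} (σ : ℕ → Fin m) (s t : ℕ) :
    (switchingWord σ s t).length = t := by
  simp [switchingWord]

lemma switchingWord_succ {m : ℕ} (σ : ℕ → Fin m) (s t : ℕ) :
    switchingWord σ s (t + 1) = σ (s + t) :: switchingWord σ s t := by
  simp [switchingWord, List.range_succ]

lemma trajectory_add {n m : ℕ} (A : Fin m → Matrix (Fin n) (Fin n) ℝ) {σ : ℕ → Fin m}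
    {x : ℕ → Fin n → ℝ} (hx : ∀ t, x (t + 1) = (A (σ t)).mulVec (x t)) (s t : ℕ) :
    x (s + t) = ((switchingWord σ s t).map A).prod.mulVec (x s) := by
  induction t with
  | zero => simp [switchingWord]
  | succ t ih =>
    rw [← add_assoc, hx, ih, switchingWord_succ, List.map_cons, List.prod_cons, mulVec_mulVec]

lemma list_prod_mem_rowStochastic {n m : ℕ} {A : Fin m → Matrix (Fin n) (Fin n) ℝ}
    (hA : ∀ k, A k ∈ rowStochastic ℝ (Fin n)) (w : List (Fin m)) :
    (w.map A).prod ∈ rowStochastic ℝ (Fin n) := by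
  refine Submonoid.list_prod_mem _ fun B hB => ?_
  obtain ⟨k, -, rfl⟩ := List.mem_map.1 hB
  exact hA k

/-- A row-stochastic matrix whose column `j` is bounded below by `δ` moves every entry of a
vector towards its `j`-th entry. -/
lemma le_mulVec_of_column_le {n : ℕ} {B : Matrix (Fin n) (Fin n) ℝ}
    (hB : B ∈ rowStochastic ℝ (Fin n)) {j : Fin n} {δ : ℝ} (hδ : ∀ i, δ ≤ B i j)
    {v : Fin n → ℝ} {a : ℝ} (ha : ∀ i, a ≤ v i) (i : Fin n) :
    a + δ * (v j - a) ≤ B.mulVec v i := by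
  have hsum : B.mulVec v i - a = ∑ k, B i k * (v k - a) := by
    simp only [mul_sub, Finset.sum_sub_distrib, ← Finset.sum_mul,
      sum_row_of_mem_rowStochastic hB, one_mul]
    rfl
  have hle : B i j * (v j - a) ≤ ∑ k, B i k * (v k - a) :=
    Finset.single_le_sum (f := fun k => B i k * (v k - a))
      (fun k _ => mul_nonneg (nonneg_of_mem_rowStochastic hB) (sub_nonneg.2 (ha k)))
      (Finset.mem_univ j)
  have := mul_le_mul_of_nonneg_right (hδ i) (sub_nonneg.2 (ha j))
  linarith

lemma mulVec_le_of_column_le {n : ℕ} {B : Matrix (Fin n) (Fin n) ℝ}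
    (hB : B ∈ rowStochastic ℝ (Fin n)) {j : Fin n} {δ : ℝ} (hδ : ∀ i, δ ≤ B i j)
    {v : Fin n → ℝ} {b : ℝ} (hb : ∀ i, v i ≤ b) (i : Fin n) :
    B.mulVec v i ≤ b - δ * (b - v j) := by
  have := le_mulVec_of_column_le hB hδ (v := -v) (a := -b) (fun k => by simpa using hb k) i
  rw [mulVec_neg] at this
  simp only [Pi.neg_apply] at this
  linarith

lemma mulVec_mem_Icc {n : ℕ} {B : Matrix (Fin n) (Fin n) ℝ}
    (hB : B ∈ rowStochastic ℝ (Fin n)) {v : Fin n → ℝ} {a b : ℝ}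
    (h : ∀ i, v i ∈ Set.Icc a b) (i : Fin n) : B.mulVec v i ∈ Set.Icc a b := by
  have hδ : ∀ k, 0 ≤ B k i := fun k => nonneg_of_mem_rowStochastic hB
  have h₁ := le_mulVec_of_column_le hB hδ (fun k => (h k).1) i
  have h₂ := mulVec_le_of_column_le hB hδ (fun k => (h k).2) i
  constructor <;> linarith

/-- A sequence of vectors that is eventually confined to arbitrarily small cubes around the
diagonal converges to a consensus vector. -/
lemma exists_tendsto_const_of_mem_Icc {n : ℕ} (x : ℕ → Fin n → ℝ)
    (h : ∀ ε > 0, ∃ N a b, b - a < ε ∧ ∀ t ≥ N, ∀ i, x t i ∈ Set.Icc a b) :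
    ∃ c : ℝ, Tendsto x atTop (𝓝 fun _ => c) := by
  rcases isEmpty_or_nonempty (Fin n) with hn | ⟨⟨i₀⟩⟩
  · exact ⟨0, tendsto_pi_nhds.2 fun i => hn.elim i⟩
  have hcauchy : CauchySeq fun t => x t i₀ := by
    refine Metric.cauchySeq_iff.2 fun ε hε => ?_
    obtain ⟨N, a, b, hab, hN⟩ := h ε hε
    exact ⟨N, fun s hs t ht =>
      (Real.dist_le_of_mem_Icc (hN s hs i₀) (hN t ht i₀)).trans_lt hab⟩
  obtain ⟨c, hc⟩ := cauchySeq_tendsto_of_complete hcauchy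
  refine ⟨c, tendsto_pi_nhds.2 fun i => ?_⟩
  refine hc.congr_dist (Metric.tendsto_atTop.2 fun ε hε => ?_)
  obtain ⟨N, a, b, hab, hN⟩ := h ε hε
  refine ⟨N, fun t ht => ?_⟩
  rw [Real.dist_0_eq_abs, abs_of_nonneg dist_nonneg]
  exact (Real.dist_le_of_mem_Icc (hN t ht i₀) (hN t ht i)).trans_lt hab

/-- If a product of the matrices has a positive column, repeating its word drives every
trajectory to consensus. -/
lemma exists_consensus_switching {n m : ℕ} {A : Fin m → Matrix (Fin n) (Fin n) ℝ}
    (hA : ∀ k, A k ∈ rowStochastic ℝ (Fin n)) {w : List (Fin m)} (hw : w ≠ []) {j : Fin n}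
    (hj : ∀ i, 0 < (w.map A).prod i j) :
    ∃ σ : ℕ → Fin m, ∀ x : ℕ → Fin n → ℝ,
      (∀ t, x (t + 1) = (A (σ t)).mulVec (x t)) →
      ∃ a : ℝ, Tendsto x atTop (𝓝 (fun _ => a)) := by
  have hl : 0 < w.length := List.length_pos_iff.2 hw
  let σ : ℕ → Fin m := fun t =>
    w.reverse[t % w.length]'(by simpa using Nat.mod_lt t hl)
  have hσ (k : ℕ) : switchingWord σ (w.length * k) w.length = w := by
    rw [← List.reverse_inj]
    refine List.ext_getElem (by simp [switchingWord]) fun i h₁ h₂ => ?_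
    have hi : i < w.length := by simpa using h₂
    simp [switchingWord, σ, Nat.mod_eq_of_lt hi]
  refine ⟨σ, fun x hx => exists_tendsto_const_of_mem_Icc x fun ε hε => ?_⟩
  have hn : Nonempty (Fin n) := ⟨j⟩
  set B := (w.map A).prod
  have hB : B ∈ rowStochastic ℝ (Fin n) := list_prod_mem_rowStochastic hA w
  obtain ⟨i₁, hi₁⟩ := Finite.exists_min fun i => B i j
  obtain ⟨imin, himin⟩ := Finite.exists_min (x 0)
  obtain ⟨imax, himax⟩ := Finite.exists_max (x 0)
  have hδ1 : B i₁ j ≤ 1 := le_one_of_mem_rowStochastic hB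
  have key (k : ℕ) : ∃ a b, b - a = (1 - B i₁ j) ^ k * (x 0 imax - x 0 imin) ∧
      ∀ i, x (w.length * k) i ∈ Set.Icc a b := by
    induction k with
    | zero => exact ⟨x 0 imin, x 0 imax, by simp, fun i => ⟨himin i, himax i⟩⟩
    | succ k ih =>
      obtain ⟨a, b, hab, h⟩ := ih
      refine ⟨a + B i₁ j * (x (w.length * k) j - a), b - B i₁ j * (b - x (w.length * k) j),
        by rw [pow_succ, mul_right_comm, ← hab]; ring, fun i => ?_⟩
      rw [Nat.mul_succ, trajectory_add A hx, hσ]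
      exact ⟨le_mulVec_of_column_le hB hi₁ (fun i => (h i).1) i,
        mulVec_le_of_column_le hB hi₁ (fun i => (h i).2) i⟩
  have hlim : Tendsto (fun k : ℕ => (1 - B i₁ j) ^ k * (x 0 imax - x 0 imin)) atTop (𝓝 0) := by
    simpa using (tendsto_pow_atTop_nhds_zero_of_lt_one (sub_nonneg.2 hδ1)
      (sub_lt_self 1 (hj i₁))).mul_const (x 0 imax - x 0 imin)
  obtain ⟨k, hk⟩ := (hlim.eventually_lt_const hε).exists
  obtain ⟨a, b, hab, h⟩ := key k
  refine ⟨w.length * k, a, b, hab ▸ hk, fun t ht i => ?_⟩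
  obtain ⟨s, rfl⟩ := Nat.exists_eq_add_of_le ht
  rw [trajectory_add A hx]
  exact mulVec_mem_Icc (list_prod_mem_rowStochastic hA _) h i

/-- If every trajectory of some switching sequence reaches consensus, some nonempty product of
the matrices has a positive column. -/
lemma exists_positive_column {n m : ℕ} (hn : 0 < n) {A : Fin m → Matrix (Fin n) (Fin n) ℝ}
    (hA : ∀ k, A k ∈ rowStochastic ℝ (Fin n)) {σ : ℕ → Fin m}
    (hσ : ∀ x : ℕ → Fin n → ℝ, (∀ t, x (t + 1) = (A (σ t)).mulVec (x t)) →
      ∃ a : ℝ, Tendsto x atTop (𝓝 (fun _ => a))) :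
    ∃ w : List (Fin m), w ≠ [] ∧ ∃ j, ∀ i, 0 < (w.map A).prod i j := by
  let W : ℕ → Matrix (Fin n) (Fin n) ℝ := fun t => ((switchingWord σ 0 t).map A).prod
  have hcol (j : Fin n) : ∃ a : ℝ, ∀ i, Tendsto (fun t => W t i j) atTop (𝓝 a) := by
    obtain ⟨a, ha⟩ := hσ (fun t => (W t).mulVec (Pi.single j 1)) fun t => by
      simp only [W, switchingWord_succ, List.map_cons, List.prod_cons, mulVec_mulVec, zero_add]
    refine ⟨a, fun i => ?_⟩
    simpa using tendsto_pi_nhds.1 ha i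
  choose a ha using hcol
  have hsum : ∑ j, a j = 1 := by
    refine tendsto_nhds_unique (tendsto_finsetSum _ fun j _ => ha j ⟨0, hn⟩) ?_
    simp [W, sum_row_of_mem_rowStochastic (list_prod_mem_rowStochastic hA _)]
  obtain ⟨j, -, hj⟩ : ∃ j ∈ Finset.univ, 0 < a j :=
    Finset.exists_lt_of_sum_lt (by simp [hsum])
  obtain ⟨t, ht, ht0⟩ := ((eventually_all.2 fun i => (ha j i).eventually_const_lt hj).and
    (eventually_gt_atTop 0)).exists
  refine ⟨switchingWord σ 0 t, ?_, j, ht⟩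
  rwa [← List.length_pos_iff, length_switchingWord]

/-- For a finite set `M = {A 0, …, A (m-1)}` of `n × n` row-stochastic real
matrices, there exists a switching sequence `σ : ℕ → Fin m` such that every trajectory
`x (t+1) = A (σ t) ⬝ x t` converges to a consensus vector, if and only if `M` is
column-primitive, i.e. some nonempty finite product of matrices from `M` has a strictly
positive column. -/
theorem stmt0 (n m : ℕ) (hn : 0 < n) (hm : 0 < m)
    (A : Fin m → Matrix (Fin n) (Fin n) ℝ)
    (hnonneg : ∀ k i j, 0 ≤ A k i j)
    (hrow : ∀ k i, ∑ j, A k i j = 1) :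
    (∃ σ : ℕ → Fin m, ∀ x : ℕ → Fin n → ℝ,
        (∀ t, x (t + 1) = (A (σ t)).mulVec (x t)) →
        ∃ a : ℝ, Tendsto x atTop (𝓝 (fun _ => a)))
    ↔ (∃ w : List (Fin m), w ≠ [] ∧ ∃ j, ∀ i, 0 < (w.map A).prod i j) := by
  have hA (k : Fin m) : A k ∈ rowStochastic ℝ (Fin n) :=
    mem_rowStochastic_iff_sum.2 ⟨hnonneg k, hrow k⟩
  exact ⟨fun ⟨_, hσ⟩ => exists_positive_column hn hA hσ,
    fun ⟨_, hw, _, hj⟩ => exists_consensus_switching hA hw hj⟩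
end

section
/- Let A_1, ..., A_m be n×n row-stochastic matrices and let w = w_l ... w_1 be a word over {1,...,m} such that A_w = A_{w_l} ⋯ A_{w_1} has a strictly positive column. Then for every initial vector x_0 ∈ ℝ^n, the trajectory of the system x(t+1) = A_{w_{(t mod l)+1}} x(t), x(0) = x_0, obtained by applying the word w periodically, converges to a consensus vector a·1 for some a ∈ ℝ. -/
open Matrix Filter Topology

section RowStochastic

variable {ι : Type*} [Fintype ι] [DecidableEq ι] {P : Matrix ι ι ℝ}

/-- If the `j`-th column of a row-stochastic matrix is at least `δ`, the image of a vector bounded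
by `c` is bounded by the corresponding convex combination of `c` and the `j`-th entry. -/
lemma mulVec_le_of_le_col (hP : P ∈ rowStochastic ℝ ι) {j : ι} {δ : ℝ} (hδ : ∀ i, δ ≤ P i j)
    {v : ι → ℝ} {c : ℝ} (hv : ∀ i, v i ≤ c) (i : ι) :
    (P *ᵥ v) i ≤ (1 - δ) * c + δ * v j := by
  have h0 : ∀ k, 0 ≤ P i k * (c - v k) := fun k =>
    mul_nonneg (hP.1 i k) (sub_nonneg.2 (hv k))
  have h1 : P i j * (c - v j) ≤ ∑ k, P i k * (c - v k) :=
    Finset.single_le_sum (f := fun k => P i k * (c - v k)) (fun k _ => h0 k) (Finset.mem_univ j)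
  have h2 : ∑ k, P i k * (c - v k) = c - (P *ᵥ v) i := by
    simp only [mul_sub, Finset.sum_sub_distrib, ← Finset.sum_mul,
      sum_row_of_mem_rowStochastic hP i, one_mul, mulVec, dotProduct]
  have h3 : δ * (c - v j) ≤ P i j * (c - v j) :=
    mul_le_mul_of_nonneg_right (hδ i) (sub_nonneg.2 (hv j))
  linarith

lemma le_mulVec_of_le_col (hP : P ∈ rowStochastic ℝ ι) {j : ι} {δ : ℝ} (hδ : ∀ i, δ ≤ P i j)
    {v : ι → ℝ} {c : ℝ} (hv : ∀ i, c ≤ v i) (i : ι) :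
    (1 - δ) * c + δ * v j ≤ (P *ᵥ v) i := by
  have h := mulVec_le_of_le_col hP hδ (v := -v) (c := -c) (fun i => neg_le_neg (hv i)) i
  simp only [mulVec_neg, Pi.neg_apply] at h
  linarith

lemma mulVec_le_of_forall_le (hP : P ∈ rowStochastic ℝ ι) {v : ι → ℝ} {c : ℝ}
    (hv : ∀ i, v i ≤ c) (i : ι) : (P *ᵥ v) i ≤ c := by
  simpa using mulVec_le_of_le_col hP (j := i) (δ := 0) (fun k => hP.1 k i) hv i

lemma le_mulVec_of_forall_le (hP : P ∈ rowStochastic ℝ ι) {v : ι → ℝ} {c : ℝ}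
    (hv : ∀ i, c ≤ v i) (i : ι) : c ≤ (P *ᵥ v) i := by
  simpa using le_mulVec_of_le_col hP (j := i) (δ := 0) (fun k => hP.1 k i) hv i

end RowStochastic

/-- Running a time-varying linear system for `s` steps multiplies the state by the product of
the matrices applied. -/
lemma eq_reverse_prod_mulVec {ι : Type*} [Fintype ι] [DecidableEq ι] (B : ℕ → Matrix ι ι ℝ)
    (y : ℕ → ι → ℝ) (s : ℕ) (hy : ∀ t < s, y (t + 1) = B t *ᵥ y t) :
    y s = (List.ofFn fun r : Fin s => B r).reverse.prod *ᵥ y 0 := by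
  induction s with
  | zero => simp
  | succ s ih =>
    rw [hy s s.lt_succ_self, ih fun t ht => hy t (ht.trans s.lt_succ_self), mulVec_mulVec,
      List.ofFn_succ_last]
    simp

/-- A trajectory of row-stochastic steps converges to consensus if, every `l` steps, it is
multiplied by one fixed row-stochastic matrix with a positive column. -/
lemma tendsto_consensus {ι : Type*} [Fintype ι] [DecidableEq ι] {l : ℕ} (hl : 0 < l)
    {B : ℕ → Matrix ι ι ℝ} (hB : ∀ t, B t ∈ rowStochastic ℝ ι)
    {P : Matrix ι ι ℝ} (hP : P ∈ rowStochastic ℝ ι) {j : ι} (hj : ∀ i, 0 < P i j)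
    {x : ℕ → ι → ℝ} (hx : ∀ t, x (t + 1) = B t *ᵥ x t)
    (hxP : ∀ k, x (k * l + l) = P *ᵥ x (k * l)) :
    ∃ a : ℝ, Tendsto x atTop (𝓝 fun _ => a) := by
  have : Nonempty ι := ⟨j⟩
  obtain ⟨i₀, hi₀⟩ := Finite.exists_min fun i => P i j
  set hi : ℕ → ℝ := fun t => ⨆ i, x t i
  set lo : ℕ → ℝ := fun t => ⨅ i, x t i
  have le_hi : ∀ t i, x t i ≤ hi t := fun t i => le_ciSup (Set.finite_range _).bddAbove i
  have lo_le : ∀ t i, lo t ≤ x t i := fun t i => ciInf_le (Set.finite_range _).bddBelow i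
  have hi_anti : Antitone hi := antitone_nat_of_succ_le fun t => ciSup_le fun i => by
    rw [hx]; exact mulVec_le_of_forall_le (hB t) (le_hi t) i
  have lo_mono : Monotone lo := monotone_nat_of_le_succ fun t => le_ciInf fun i => by
    rw [hx]; exact le_mulVec_of_forall_le (hB t) (lo_le t) i
  have lo_le_hi : ∀ t, lo t ≤ hi t := fun t => (lo_le t j).trans (le_hi t j)
  have hi_lim := tendsto_atTop_ciInf hi_anti
    ⟨lo 0, Set.forall_mem_range.2 fun t => (lo_mono t.zero_le).trans (lo_le_hi t)⟩
  have lo_lim := tendsto_atTop_ciSup lo_mono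
    ⟨hi 0, Set.forall_mem_range.2 fun t => (lo_le_hi t).trans (hi_anti t.zero_le)⟩
  set a := ⨅ t, hi t
  set b := ⨆ t, lo t
  have contract : ∀ k, hi (k * l + l) - lo (k * l + l) ≤
      (1 - P i₀ j) * (hi (k * l) - lo (k * l)) := fun k => by
    have h1 : hi (k * l + l) ≤ (1 - P i₀ j) * hi (k * l) + P i₀ j * x (k * l) j :=
      ciSup_le fun i => by rw [hxP]; exact mulVec_le_of_le_col hP hi₀ (le_hi _) i
    have h2 : (1 - P i₀ j) * lo (k * l) + P i₀ j * x (k * l) j ≤ lo (k * l + l) :=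
      le_ciInf fun i => by rw [hxP]; exact le_mulVec_of_le_col hP hi₀ (lo_le _) i
    linarith
  have width_lim := hi_lim.sub lo_lim
  have tend : Tendsto (fun k => k * l) atTop atTop := tendsto_id.atTop_mul_const' hl
  have width_le : a - b ≤ (1 - P i₀ j) * (a - b) :=
    le_of_tendsto_of_tendsto' (width_lim.comp (tendsto_atTop_mono (fun k => Nat.le_add_right _ l) tend))
      ((width_lim.comp tend).const_mul _) contract
  have hba : b ≤ a := le_of_tendsto_of_tendsto' lo_lim hi_lim lo_le_hi
  have hab : b = a := by nlinarith [hj i₀]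
  refine ⟨a, tendsto_pi_nhds.2 fun i => ?_⟩
  exact tendsto_of_tendsto_of_tendsto_of_le_of_le (hab ▸ lo_lim) hi_lim
    (fun t => lo_le t i) fun t => le_hi t i

/-- If the word `w = w_l … w_1` (letters `u 1, …, u l`) over the index set of
row-stochastic matrices `A 0, …, A (m-1)` gives a product `A_w = A (u l) * ⋯ * A (u 1)` with a
strictly positive column, then applying the word periodically, i.e.
`x (t+1) = A (u ((t % l) + 1)) ⬝ x t`, drives every initial condition to a consensus vector. -/
theorem stmt1 (n m l : ℕ) (hl : 0 < l)
    (A : Fin m → Matrix (Fin n) (Fin n) ℝ)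
    (hnonneg : ∀ k i j, 0 ≤ A k i j)
    (hrow : ∀ k i, ∑ j, A k i j = 1)
    (u : ℕ → Fin m)
    (hpos : ∃ j, ∀ i,
      0 < ((List.ofFn fun s : Fin l => A (u ((s : ℕ) + 1))).reverse.prod) i j) :
    ∀ x : ℕ → Fin n → ℝ,
      (∀ t, x (t + 1) = (A (u (t % l + 1))).mulVec (x t)) →
      ∃ a : ℝ, Tendsto x atTop (𝓝 (fun _ => a)) := by
  intro x hx
  obtain ⟨j, hj⟩ := hpos
  have hA : ∀ k, A k ∈ rowStochastic ℝ (Fin n) := fun k =>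
    mem_rowStochastic_iff_sum.2 ⟨hnonneg k, hrow k⟩
  have hP : (List.ofFn fun s : Fin l => A (u ((s : ℕ) + 1))).reverse.prod ∈
      rowStochastic ℝ (Fin n) := list_prod_mem fun M hM => by
    obtain ⟨s, rfl⟩ := List.mem_ofFn.1 (List.mem_reverse.1 hM)
    exact hA _
  refine tendsto_consensus hl (fun t => hA (u (t % l + 1))) hP hj hx fun k => ?_
  refine eq_reverse_prod_mulVec (fun s => A (u (s + 1))) (fun s => x (k * l + s)) l
    fun s hs => ?_
  simpa [Nat.mod_eq_of_lt hs, add_assoc] using hx (k * l + s)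
end

section
/- Let A be an n×n row-stochastic matrix whose j-th column is strictly positive, and set a = min_i A_{ij}. Then for every x ∈ ℝ^n, max_i (Ax)_i − min_i (Ax)_i ≤ (1 − a) (max_i x_i − min_i x_i). -/
open Matrix Finset

/-- A convex combination giving weight at least `a` to the index `j` of values bounded above
by `M` is at most `a * x j + (1 - a) * M`. -/
theorem sum_mul_le_of_le_weight {ι : Type*} [Fintype ι] {w x : ι → ℝ} {j : ι} {a M : ℝ}
    (hw : ∀ k, 0 ≤ w k) (hsum : ∑ k, w k = 1) (ha : a ≤ w j) (hx : ∀ k, x k ≤ M) :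
    ∑ k, w k * x k ≤ a * x j + (1 - a) * M := by
  have hsingle : w j * (M - x j) ≤ ∑ k, w k * (M - x k) :=
    Finset.single_le_sum (f := fun k => w k * (M - x k))
      (fun k _ => mul_nonneg (hw k) (sub_nonneg.2 (hx k))) (Finset.mem_univ j)
  have hweight : a * (M - x j) ≤ w j * (M - x j) :=
    mul_le_mul_of_nonneg_right ha (sub_nonneg.2 (hx j))
  simp only [mul_sub, Finset.sum_sub_distrib, ← Finset.sum_mul, hsum] at hsingle hweight
  linarith

/-- A convex combination giving weight at least `a` to the index `j` of values bounded below
by `m` is at least `a * x j + (1 - a) * m`. -/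
theorem le_sum_mul_of_le_weight {ι : Type*} [Fintype ι] {w x : ι → ℝ} {j : ι} {a m : ℝ}
    (hw : ∀ k, 0 ≤ w k) (hsum : ∑ k, w k = 1) (ha : a ≤ w j) (hx : ∀ k, m ≤ x k) :
    a * x j + (1 - a) * m ≤ ∑ k, w k * x k := by
  have h := sum_mul_le_of_le_weight (x := fun k => -x k) hw hsum ha
    (fun k => neg_le_neg (hx k))
  simp only [mul_neg, Finset.sum_neg_distrib] at h
  linarith

/-- If `A` is an `n × n` row-stochastic matrix whose `j`-th column is strictly
positive and `a = min_i A i j`, then for every `x : Fin n → ℝ`,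
`max (A x) - min (A x) ≤ (1 - a) * (max x - min x)`. -/
theorem stmt2 (n : ℕ) (hn : 0 < n)
    (A : Matrix (Fin n) (Fin n) ℝ)
    (hnonneg : ∀ i j, 0 ≤ A i j)
    (hrow : ∀ i, ∑ j, A i j = 1)
    (j : Fin n) (hpos : ∀ i, 0 < A i j)
    (hne : (Finset.univ : Finset (Fin n)).Nonempty)
    (a : ℝ) (ha : a = Finset.univ.inf' hne (fun i => A i j)) :
    ∀ x : Fin n → ℝ,
      Finset.univ.sup' hne (fun i => A.mulVec x i) -
          Finset.univ.inf' hne (fun i => A.mulVec x i) ≤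
        (1 - a) * (Finset.univ.sup' hne x - Finset.univ.inf' hne x) := by
  intro x
  have hmin : ∀ i, a ≤ A i j := fun i =>
    ha ▸ Finset.inf'_le (fun i => A i j) (Finset.mem_univ i)
  have hupper : Finset.univ.sup' hne (fun i => A.mulVec x i) ≤
      a * x j + (1 - a) * Finset.univ.sup' hne x :=
    Finset.sup'_le hne _ fun i _ => sum_mul_le_of_le_weight (hnonneg i) (hrow i) (hmin i)
      fun k => Finset.le_sup' x (Finset.mem_univ k)
  have hlower : a * x j + (1 - a) * Finset.univ.inf' hne x ≤
      Finset.univ.inf' hne (fun i => A.mulVec x i) :=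
    Finset.le_inf' hne _ fun i _ => le_sum_mul_of_le_weight (hnonneg i) (hrow i) (hmin i)
      fun k => Finset.inf'_le x (Finset.mem_univ k)
  linarith
end

section
/- Let M = {A_1, ..., A_m} be a finite set of n×n matrices with nonnegative entries and no zero row, and let M' be the set of all n×n binary stochastic matrices B such that some A ∈ M dominates B (i.e., A_{ij} = 0 implies B_{ij} = 0 for all i, j). Then a word w = w_l ... w_1 over {1,...,m} is such that A_{w_l} ⋯ A_{w_1} has a strictly positive column if and only if there exist matrices B_1, ..., B_l ∈ M' with A_{w_i} dominating B_i for each i such that the product B_l ⋯ B_1 has a strictly positive column. -/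
open Matrix

/-- A square real matrix is binary stochastic if all entries are `0` or `1` and every row sums
to `1` (i.e. each row has exactly one `1`). -/
def IsBinaryStochastic {n : ℕ} (B : Matrix (Fin n) (Fin n) ℝ) : Prop :=
  (∀ i j, B i j = 0 ∨ B i j = 1) ∧ ∀ i, ∑ j, B i j = 1

/-- `A` dominates `B`: wherever `A` vanishes, so does `B`. -/
def Dominates {n : ℕ} (A B : Matrix (Fin n) (Fin n) ℝ) : Prop :=
  ∀ i j, A i j = 0 → B i j = 0

theorem Matrix.mul_apply_pos_iff {n : ℕ} {M P : Matrix (Fin n) (Fin n) ℝ}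
    (hM : ∀ i j, 0 ≤ M i j) (hP : ∀ i j, 0 ≤ P i j) (i j : Fin n) :
    0 < (M * P) i j ↔ ∃ x, 0 < M i x ∧ 0 < P x j := by
  rw [Matrix.mul_apply, Finset.sum_pos_iff_of_nonneg fun x _ => mul_nonneg (hM i x) (hP x j)]
  constructor
  · rintro ⟨x, -, hx⟩
    exact ⟨x, pos_of_mul_pos_left hx (hP x j), pos_of_mul_pos_right hx (hM i x)⟩
  · rintro ⟨x, h₁, h₂⟩
    exact ⟨x, Finset.mem_univ x, mul_pos h₁ h₂⟩

theorem Matrix.list_prod_apply_nonneg {n : ℕ} (L : List (Matrix (Fin n) (Fin n) ℝ))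
    (hL : ∀ M ∈ L, ∀ i j, 0 ≤ M i j) (i j : Fin n) : 0 ≤ L.prod i j := by
  induction L generalizing i j with
  | nil =>
    rw [List.prod_nil, Matrix.one_apply]
    split_ifs <;> norm_num
  | cons M L ih =>
    rw [List.prod_cons, Matrix.mul_apply]
    exact Finset.sum_nonneg fun x _ => mul_nonneg (hL M (by simp) i x)
      (ih (fun N hN => hL N (List.mem_cons_of_mem M hN)) x j)

theorem IsBinaryStochastic.nonneg {n : ℕ} {B : Matrix (Fin n) (Fin n) ℝ}
    (hB : IsBinaryStochastic B) (i j : Fin n) : 0 ≤ B i j := by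
  rcases hB.1 i j with h | h <;> simp [h]

/-- The binary stochastic matrix of a self-map of `Fin n`. -/
def functionMatrix {n : ℕ} (f : Fin n → Fin n) : Matrix (Fin n) (Fin n) ℝ :=
  Matrix.of fun i x => if f i = x then 1 else 0

theorem isBinaryStochastic_functionMatrix {n : ℕ} (f : Fin n → Fin n) :
    IsBinaryStochastic (functionMatrix f) := by
  refine ⟨fun i j => ?_, fun i => by simp [functionMatrix]⟩
  by_cases h : f i = j <;> simp [functionMatrix, h]

theorem dominates_functionMatrix {n : ℕ} {A : Matrix (Fin n) (Fin n) ℝ} {f : Fin n → Fin n}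
    (hf : ∀ i, A i (f i) ≠ 0) : Dominates A (functionMatrix f) := by
  intro i j h
  have hij : f i ≠ j := by
    rintro rfl
    exact hf i h
  simp [functionMatrix, hij]

theorem functionMatrix_mul_apply {n : ℕ} (f : Fin n → Fin n) (P : Matrix (Fin n) (Fin n) ℝ)
    (i j : Fin n) : (functionMatrix f * P) i j = P (f i) j := by
  simp [functionMatrix, Matrix.mul_apply]

section

variable {n m : ℕ} {A : Fin m → Matrix (Fin n) (Fin n) ℝ}

theorem map_prod_apply_nonneg (hnonneg : ∀ k i j, 0 ≤ A k i j) (w : List (Fin m))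
    (i j : Fin n) : 0 ≤ (w.map A).prod i j := by
  refine Matrix.list_prod_apply_nonneg _ (fun M hM => ?_) i j
  obtain ⟨k, -, rfl⟩ := List.mem_map.mp hM
  exact hnonneg k

theorem prod_apply_nonneg_of_forall₂ {w : List (Fin m)} {Bs : List (Matrix (Fin n) (Fin n) ℝ)}
    (h : List.Forall₂ (fun k B => IsBinaryStochastic B ∧ Dominates (A k) B) w Bs)
    (i j : Fin n) : 0 ≤ Bs.prod i j := by
  refine Matrix.list_prod_apply_nonneg _ (fun B hB => ?_) i j
  induction h with
  | nil => simp at hB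
  | cons hkB _ ih =>
    rcases List.mem_cons.mp hB with rfl | hB
    · exact hkB.1.nonneg
    · exact ih hB

theorem map_prod_apply_pos_of_forall₂ (hnonneg : ∀ k i j, 0 ≤ A k i j)
    {w : List (Fin m)} {Bs : List (Matrix (Fin n) (Fin n) ℝ)}
    (h : List.Forall₂ (fun k B => IsBinaryStochastic B ∧ Dominates (A k) B) w Bs)
    (i j : Fin n) (hpos : 0 < Bs.prod i j) : 0 < (w.map A).prod i j := by
  induction h generalizing i with
  | nil => simpa using hpos
  | @cons k B w Bs hkB hs ih =>
    rw [List.prod_cons, Matrix.mul_apply_pos_iff hkB.1.nonneg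
      (prod_apply_nonneg_of_forall₂ hs)] at hpos
    obtain ⟨x, hBx, hx⟩ := hpos
    rw [List.map_cons, List.prod_cons, Matrix.mul_apply_pos_iff (hnonneg k)
      (map_prod_apply_nonneg hnonneg w)]
    exact ⟨x, (hnonneg k i x).lt_of_ne' fun h0 => hBx.ne' (hkB.2 i x h0), ih x hx⟩

/-- Any single column of a product can be followed, as far as positivity goes, by binary
stochastic matrices dominated by the factors. -/
theorem exists_forall₂_prod_apply_pos (hnonneg : ∀ k i j, 0 ≤ A k i j)
    (hnozero : ∀ k i, ∃ j, 0 < A k i j) (w : List (Fin m)) (j : Fin n) :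
    ∃ Bs : List (Matrix (Fin n) (Fin n) ℝ),
      List.Forall₂ (fun k B => IsBinaryStochastic B ∧ Dominates (A k) B) w Bs ∧
      ∀ i, 0 < (w.map A).prod i j → 0 < Bs.prod i j := by
  induction w with
  | nil => exact ⟨[], .nil, fun i hi => by simpa using hi⟩
  | cons k w ih =>
    obtain ⟨Bs, hBs, hpos⟩ := ih
    have hex : ∀ i, ∃ x, 0 < A k i x ∧
        (0 < ((k :: w).map A).prod i j → 0 < (w.map A).prod x j) := by
      intro i
      by_cases hi : 0 < ((k :: w).map A).prod i j
      · have hi' := hi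
        rw [List.map_cons, List.prod_cons, Matrix.mul_apply_pos_iff (hnonneg k)
          (map_prod_apply_nonneg hnonneg w)] at hi'
        obtain ⟨x, hx, hx'⟩ := hi'
        exact ⟨x, hx, fun _ => hx'⟩
      · obtain ⟨x, hx⟩ := hnozero k i
        exact ⟨x, hx, fun h => absurd h hi⟩
    choose f hf hfpos using hex
    refine ⟨functionMatrix f :: Bs, .cons ⟨isBinaryStochastic_functionMatrix f,
      dominates_functionMatrix fun i => (hf i).ne'⟩ hBs, fun i hi => ?_⟩
    rw [List.prod_cons, functionMatrix_mul_apply]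
    exact hpos _ (hfpos i hi)

end

/-- Let `A 0, …, A (m-1)` be nonnegative `n × n` matrices with no zero row.
A word `w` is positive-column for this set if and only if one can choose, letter by letter,
binary stochastic matrices dominated by the corresponding matrices of the word whose product
has a strictly positive column (such matrices belong to the associated semi-automaton `M'`). -/
theorem stmt5 (n m : ℕ)
    (A : Fin m → Matrix (Fin n) (Fin n) ℝ)
    (hnonneg : ∀ k i j, 0 ≤ A k i j)
    (hnozero : ∀ k i, ∃ j, 0 < A k i j)
    (w : List (Fin m)) :
    (∃ j, ∀ i, 0 < (w.map A).prod i j)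
    ↔ (∃ Bs : List (Matrix (Fin n) (Fin n) ℝ),
        List.Forall₂ (fun k B => IsBinaryStochastic B ∧ Dominates (A k) B) w Bs ∧
        ∃ j, ∀ i, 0 < Bs.prod i j) := by
  constructor
  · rintro ⟨j, hj⟩
    obtain ⟨Bs, hBs, hpos⟩ := exists_forall₂_prod_apply_pos hnonneg hnozero w j
    exact ⟨Bs, hBs, j, fun i => hpos i (hj i)⟩
  · rintro ⟨Bs, hBs, j, hj⟩
    exact ⟨j, fun i => map_prod_apply_pos_of_forall₂ hnonneg hBs i j (hj i)⟩
end

section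
/- Let M be a finite set of n×n matrices with nonnegative entries and no zero row. If M is column-primitive, then M has a positive-column word of length at most (n³ − n)/6; that is, there exists a word w_l ... w_1 over the index set of M with l ≤ (n³ − n)/6 such that the product A_{w_l} ⋯ A_{w_1} has a column all of whose entries are strictly positive. -/
open Matrix

/-- The space of functions `ℝ × ℝ → ℝ` given by polynomials of total degree at most `c`. -/
noncomputable def planePoly (c : ℕ) : Submodule ℝ (ℝ × ℝ → ℝ) :=
  Submodule.span ℝ {f | ∃ a b : ℕ, a + b ≤ c ∧ f = fun p => p.1 ^ a * p.2 ^ b}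

lemma mul_linear_mem_planePoly {c : ℕ} {f : ℝ × ℝ → ℝ} (hf : f ∈ planePoly c) (r s t : ℝ) :
    (fun p : ℝ × ℝ => (r + s * p.1 + t * p.2) * f p) ∈ planePoly (c + 1) := by
  induction hf using Submodule.span_induction with
  | mem f hf =>
    obtain ⟨a, b, hab, rfl⟩ := hf
    have mem : ∀ a' b' : ℕ, a' + b' ≤ c + 1 →
        (fun p : ℝ × ℝ => p.1 ^ a' * p.2 ^ b') ∈ planePoly (c + 1) :=
      fun a' b' h => Submodule.subset_span ⟨a', b', h, rfl⟩
    convert add_mem (add_mem (Submodule.smul_mem _ r (mem a b (by omega)))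
      (Submodule.smul_mem _ s (mem (a + 1) b (by omega))))
      (Submodule.smul_mem _ t (mem a (b + 1) (by omega))) using 1
    funext p
    simp only [Pi.add_apply, Pi.smul_apply, smul_eq_mul]
    ring
  | zero =>
    simp only [Pi.zero_apply, mul_zero]
    exact (planePoly (c + 1)).zero_mem
  | add f g _ _ hf hg =>
    convert add_mem hf hg using 1
    funext p
    simp only [Pi.add_apply]
    ring
  | smul k f _ hf =>
    convert Submodule.smul_mem _ k hf using 1
    funext p
    simp only [Pi.smul_apply, smul_eq_mul]
    ring

lemma prod_linear_mem_planePoly {α : Type*} (C : Finset α) (r s t : α → ℝ) :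
    (fun p : ℝ × ℝ => ∏ z ∈ C, (r z + s z * p.1 + t z * p.2)) ∈ planePoly C.card := by
  classical
  induction C using Finset.induction_on with
  | empty => exact Submodule.subset_span ⟨0, 0, by simp, by simp⟩
  | insert z C hz ih =>
    simp only [Finset.prod_insert hz, Finset.card_insert_of_notMem hz]
    exact mul_linear_mem_planePoly ih _ _ _

lemma card_monomials_le (c : ℕ) :
    ((Finset.range (c + 1)).biUnion Finset.HasAntidiagonal.antidiagonal).card ≤ (c + 2).choose 2 := by
  refine Finset.card_biUnion_le.trans ?_
  simp only [Finset.Nat.card_antidiagonal]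
  induction c with
  | zero => simp
  | succ c ih =>
    rw [Finset.sum_range_succ, show (c + 1 + 2).choose 2 = c + 2 + (c + 2).choose 2 by
      rw [Nat.choose_succ_succ' (c + 2) 1, Nat.choose_one_right]]
    omega

lemma planePoly_eq_span_image (c : ℕ) :
    planePoly c = Submodule.span ℝ
      ((fun (q : ℕ × ℕ) (p : ℝ × ℝ) => p.1 ^ q.1 * p.2 ^ q.2) ''
        ((Finset.range (c + 1)).biUnion Finset.HasAntidiagonal.antidiagonal : Finset (ℕ × ℕ))) := by
  unfold planePoly
  congr 1
  ext f
  constructor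
  · rintro ⟨a, b, hab, rfl⟩
    exact ⟨(a, b), by simp; omega, rfl⟩
  · rintro ⟨⟨a, b⟩, hab, rfl⟩
    simp only [Finset.coe_biUnion, Set.mem_iUnion, Finset.mem_coe, Finset.mem_range,
      Finset.HasAntidiagonal.mem_antidiagonal] at hab
    obtain ⟨s, hs, h⟩ := hab
    exact ⟨a, b, by omega, rfl⟩

instance finiteDimensional_planePoly (c : ℕ) : FiniteDimensional ℝ (planePoly c) := by
  rw [planePoly_eq_span_image]
  exact FiniteDimensional.span_of_finite ℝ ((Finset.finite_toSet _).image _)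

lemma finrank_planePoly_le (c : ℕ) :
    Module.finrank ℝ (planePoly c) ≤ (c + 2).choose 2 := by
  classical
  rw [planePoly_eq_span_image, ← Finset.coe_image]
  exact (finrank_span_finset_le_card _).trans (Finset.card_image_le.trans (card_monomials_le c))

/-- Functions that are triangular with respect to a sequence of points are linearly
independent. -/
lemma linearIndependent_of_triangular_eval {X : Type*} {l : ℕ} (f : Fin l → X → ℝ)
    (p : Fin l → X) (hdiag : ∀ i, f i (p i) ≠ 0) (hzero : ∀ i j, j < i → f j (p i) = 0) :
    LinearIndependent ℝ f := by
  have htri : (Matrix.of fun j i => f j (p i)).det ≠ 0 := by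
    rw [Matrix.det_of_isLowerTriangular (Matrix.of fun j i => f j (p i))
      fun j i hij => hzero i j hij]
    exact Finset.prod_ne_zero_iff.2 fun i _ => hdiag i
  exact LinearIndependent.of_comp (LinearMap.funLeft ℝ ℝ p)
    (Matrix.linearIndependent_rows_of_det_ne_zero htri)

/-- The skew Bollobás inequality for pairs against sets of size `c`. -/
lemma skew_bollobas_pairs {α : Type*} [Fintype α] {l c : ℕ} (C : Fin l → Finset α)
    (x y : Fin l → α) (hcard : ∀ i, (C i).card = c)
    (hdisj : ∀ i, x i ∉ C i ∧ y i ∉ C i)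
    (hmeet : ∀ i j, j < i → x i ∈ C j ∨ y i ∈ C j) :
    l ≤ (c + 2).choose 2 := by
  let t : α → ℝ := fun a => (Fintype.equivFin α a : ℕ)
  have ht : Function.Injective t := fun a b h =>
    (Fintype.equivFin α).injective (Fin.ext (Nat.cast_injective h))
  let f : Fin l → ℝ × ℝ → ℝ := fun j p =>
    ∏ z ∈ C j, (t z ^ 2 + -t z * p.1 + 1 * p.2)
  let p : Fin l → ℝ × ℝ := fun i => (t (x i) + t (y i), t (x i) * t (y i))
  have hfp : ∀ i j, f j (p i) = ∏ z ∈ C j, (t z - t (x i)) * (t z - t (y i)) := fun i j =>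
    Finset.prod_congr rfl fun z _ => by ring
  have hli : LinearIndependent ℝ f := by
    refine linearIndependent_of_triangular_eval f p (fun i => ?_) fun i j hij => ?_
    · rw [hfp]
      refine Finset.prod_ne_zero_iff.2 fun z hz => mul_ne_zero ?_ ?_
      · exact sub_ne_zero.2 fun h => (hdisj i).1 (ht h ▸ hz)
      · exact sub_ne_zero.2 fun h => (hdisj i).2 (ht h ▸ hz)
    · rw [hfp]
      rcases hmeet i j hij with h | h <;> exact Finset.prod_eq_zero h (by ring)
  have hmem : ∀ j, f j ∈ planePoly c := fun j =>
    hcard j ▸ prod_linear_mem_planePoly (C j) _ _ _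
  have hli' : LinearIndependent ℝ fun j => (⟨f j, hmem j⟩ : planePoly c) :=
    LinearIndependent.of_comp (planePoly c).subtype hli
  simpa using hli'.fintype_card_le_finrank.trans (finrank_planePoly_le c)

/-- The transformation induced by a word, read from left to right. -/
def runWord {ι α : Type*} (δ : ι → α → α) (w : List ι) (x : α) : α :=
  w.foldl (fun x a => δ a x) x

lemma runWord_append {ι α : Type*} (δ : ι → α → α) (u v : List ι) (x : α) :
    runWord δ (u ++ v) x = runWord δ v (runWord δ u x) :=
  List.foldl_append

lemma runWord_drop_take {ι α : Type*} (δ : ι → α → α) (w : List ι) (i : ℕ) (x : α) :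
    runWord δ (w.drop i) (runWord δ (w.take i) x) = runWord δ w x := by
  rw [← runWord_append, List.take_append_drop]

/-- If some word fails to be injective on `S`, then so does one of length at most
`(|α| - |S| + 2).choose 2`. -/
lemma exists_short_not_injOn {ι α : Type*} [Fintype α] (δ : ι → α → α) (S : Finset α)
    (h : ∃ w, ¬ Set.InjOn (runWord δ w) S) :
    ∃ w, ¬ Set.InjOn (runWord δ w) S ∧
      w.length ≤ (Fintype.card α - S.card + 2).choose 2 := by
  classical
  obtain ⟨w, hw, hmin⟩ :=
    WellFounded.has_min (measure (List.length (α := ι))).wf {w | ¬ Set.InjOn (runWord δ w) S} h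
  have hshort : ∀ v : List ι, v.length < w.length → Set.InjOn (runWord δ v) S := fun v hv =>
    by_contra fun hv' => hmin v hv' hv
  refine ⟨w, hw, ?_⟩
  have hw' : ¬ Set.InjOn (runWord δ w) S := hw
  simp only [Set.InjOn, not_forall] at hw'
  obtain ⟨x, hx, y, hy, hxy, hne⟩ := hw'
  have htake : ∀ i : Fin w.length, Set.InjOn (runWord δ (w.take i)) S := fun i =>
    hshort _ (by simp)
  refine skew_bollobas_pairs (fun i : Fin w.length => (S.image (runWord δ (w.take i)))ᶜ)
    (fun i => runWord δ (w.take i) x) (fun i => runWord δ (w.take i) y) (fun i => ?_)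
    (fun i => ?_) fun i j hij => ?_
  · rw [Finset.card_compl, Finset.card_image_of_injOn (htake i)]
  · simp only [Finset.mem_compl, not_not]
    exact ⟨Finset.mem_image_of_mem _ hx, Finset.mem_image_of_mem _ hy⟩
  · simp only [Finset.mem_compl]
    by_contra! hcon
    obtain ⟨x', hx', hxx⟩ := Finset.mem_image.1 hcon.1
    obtain ⟨y', hy', hyy⟩ := Finset.mem_image.1 hcon.2
    have hinj : Set.InjOn (runWord δ (w.take j ++ w.drop i)) S := hshort _ (by
      have := i.isLt
      have : (j : ℕ) < i := hij
      simp only [List.length_append, List.length_take, List.length_drop]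
      omega)
    have hx'y' : x' = y' := hinj hx' hy' (by
      rw [runWord_append, runWord_append, hxx, hyy, runWord_drop_take, runWord_drop_take, hxy])
    subst hx'y'
    exact hne (htake i hx hy (hxx.symm.trans hyy))

/-- Greedy compression: `d` successive rank drops cost at most `(d + 2).choose 3` letters. -/
lemma exists_short_card_image_le {ι α : Type*} [Fintype α] [DecidableEq α] (δ : ι → α → α)
    (hsync : ∃ w, ∃ b, ∀ x, runWord δ w x = b) (d : ℕ) (hd : d < Fintype.card α) :
    ∃ w, (Finset.univ.image (runWord δ w)).card ≤ Fintype.card α - d ∧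
      w.length ≤ (d + 2).choose 3 := by
  induction d with
  | zero => exact ⟨[], Finset.card_le_univ _, by simp⟩
  | succ d ih =>
    obtain ⟨w, hcard, hlen⟩ := ih (by omega)
    have hchoose : (d + 1 + 2).choose 3 = (d + 2).choose 2 + (d + 2).choose 3 :=
      Nat.choose_succ_succ' (d + 2) 2
    by_cases hlt : (Finset.univ.image (runWord δ w)).card ≤ Fintype.card α - (d + 1)
    · exact ⟨w, hlt, by omega⟩
    · set S := Finset.univ.image (runWord δ w) with hS
      obtain ⟨v, hv, hvlen⟩ := exists_short_not_injOn δ S (by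
        obtain ⟨u, b, hu⟩ := hsync
        obtain ⟨x, hx, y, hy, hne⟩ := Finset.one_lt_card.1 (show 1 < S.card by omega)
        exact ⟨u, fun hinj => hne (hinj hx hy ((hu x).trans (hu y).symm))⟩)
      refine ⟨w ++ v, ?_, ?_⟩
      · have himage : Finset.univ.image (runWord δ (w ++ v)) = S.image (runWord δ v) := by
          rw [hS, Finset.image_image]
          exact Finset.image_congr fun x _ => runWord_append δ w v x
        have hne : (S.image (runWord δ v)).card ≠ S.card :=
          fun h => hv (Finset.card_image_iff.1 h)
        have hle : (S.image (runWord δ v)).card ≤ S.card := Finset.card_image_le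
        rw [himage]
        omega
      · have : Fintype.card α - S.card = d := by omega
        rw [this] at hvlen
        rw [List.length_append]
        omega

lemma choose_succ_three_eq (n : ℕ) : (n + 1).choose 3 = (n ^ 3 - n) / 6 := by
  have h6 : 6 * (n + 1).choose 3 + n = n ^ 3 := by
    induction n with
    | zero => rfl
    | succ n ih =>
      have h2 : 2 * (n + 1).choose 2 = (n + 1) * n := by
        rw [Nat.choose_two_right, Nat.mul_div_cancel' (Nat.even_mul_pred_self _).two_dvd]
        simp
      rw [Nat.choose_succ_succ' (n + 1) 2]
      linarith [h2, ih, show (n + 1) ^ 3 = n ^ 3 + 3 * ((n + 1) * n) + 1 by ring]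
  omega

/-- The Pin–Frankl bound: a synchronizing family of transformations of a set with `n ≥ 1`
elements has a synchronizing word of length at most `(n ^ 3 - n) / 6`. -/
theorem exists_short_synchronizing_word {ι α : Type*} [Fintype α] [Nonempty α] (δ : ι → α → α)
    (hsync : ∃ w, ∃ b, ∀ x, runWord δ w x = b) :
    ∃ w, w.length ≤ (Fintype.card α ^ 3 - Fintype.card α) / 6 ∧
      ∃ b, ∀ x, runWord δ w x = b := by
  classical
  have hpos : 0 < Fintype.card α := Fintype.card_pos
  obtain ⟨w, hcard, hlen⟩ :=
    exists_short_card_image_le δ hsync (Fintype.card α - 1) (by omega)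
  refine ⟨w, ?_, runWord δ w (Classical.arbitrary α), fun x => ?_⟩
  · rwa [← choose_succ_three_eq, show Fintype.card α + 1 = Fintype.card α - 1 + 2 by omega]
  · exact Finset.card_le_one.1 (hcard.trans (by omega)) _ (by simp) _ (by simp)

/-- The transformations choosing, for each row of some `A k`, the position of a positive entry. -/
abbrev PositiveSelection {κ α : Type*} (A : κ → Matrix α α ℝ) :=
  {q : κ × (α → α) // ∀ i, 0 < A q.1 i (q.2 i)}

section Matrices

variable {κ α : Type*} [Fintype α] [DecidableEq α] {A : κ → Matrix α α ℝ}

lemma prod_map_nonneg (hnonneg : ∀ k i j, 0 ≤ A k i j) (w : List κ) (i j : α) :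
    0 ≤ (w.map A).prod i j := by
  induction w generalizing i with
  | nil =>
    rw [List.map_nil, List.prod_nil, Matrix.one_apply]
    split_ifs <;> norm_num
  | cons k w ih =>
    rw [List.map_cons, List.prod_cons, Matrix.mul_apply]
    exact Finset.sum_nonneg fun a _ => mul_nonneg (hnonneg k i a) (ih a)

lemma prod_map_runWord_pos (hnonneg : ∀ k i j, 0 ≤ A k i j)
    (w : List (PositiveSelection A)) (i : α) :
    0 < ((w.map fun q => q.1.1).map A).prod i (runWord (fun q => q.1.2) w i) := by
  induction w generalizing i with
  | nil => simp [runWord]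
  | cons q w ih =>
    rw [List.map_cons, List.map_cons, List.prod_cons, Matrix.mul_apply]
    exact Finset.sum_pos' (fun a _ => mul_nonneg (hnonneg _ i a) (prod_map_nonneg hnonneg _ a _))
      ⟨q.1.2 i, Finset.mem_univ _, mul_pos (q.2 i) (ih _)⟩

lemma exists_selection_word (hnonneg : ∀ k i j, 0 ≤ A k i j) (hnozero : ∀ k i, ∃ j, 0 < A k i j)
    (w : List κ) (j : α) :
    ∃ v : List (PositiveSelection A),
      ∀ i, 0 < (w.map A).prod i j → runWord (fun q => q.1.2) v i = j := by
  induction w with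
  | nil =>
    refine ⟨[], fun i hi => ?_⟩
    by_contra hne
    have hne' : i ≠ j := hne
    simp [Matrix.one_apply_ne hne'] at hi
  | cons k w ih =>
    obtain ⟨v, hv⟩ := ih
    have hsel : ∀ i, ∃ a, 0 < A k i a ∧
        (0 < ((k :: w).map A).prod i j → 0 < (w.map A).prod a j) := by
      intro i
      by_cases hi : 0 < ((k :: w).map A).prod i j
      · rw [List.map_cons, List.prod_cons, Matrix.mul_apply] at hi
        obtain ⟨a, -, ha⟩ := Finset.exists_lt_of_sum_lt
          (s := Finset.univ) (f := fun _ => (0 : ℝ)) (by simpa using hi)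
        exact ⟨a, pos_of_mul_pos_left ha (prod_map_nonneg hnonneg w a j),
          fun _ => pos_of_mul_pos_right ha (hnonneg k i a)⟩
      · obtain ⟨a, ha⟩ := hnozero k i
        exact ⟨a, ha, fun h => absurd h hi⟩
    choose f hf hfw using hsel
    exact ⟨⟨(k, f), hf⟩ :: v, fun i hi => hv (f i) (hfw i hi)⟩

end Matrices

/-- If a finite set of nonnegative `n × n` matrices with no zero row is
column-primitive, then it has a positive-column word of length at most `(n³ - n) / 6`. -/
theorem stmt6 (n m : ℕ)
    (A : Fin m → Matrix (Fin n) (Fin n) ℝ)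
    (hnonneg : ∀ k i j, 0 ≤ A k i j)
    (hnozero : ∀ k i, ∃ j, 0 < A k i j)
    (hprim : ∃ w : List (Fin m), ∃ j, ∀ i, 0 < (w.map A).prod i j) :
    ∃ w : List (Fin m), w.length ≤ (n ^ 3 - n) / 6 ∧
      ∃ j, ∀ i, 0 < (w.map A).prod i j := by
  obtain ⟨w, j, hw⟩ := hprim
  obtain ⟨v, hv⟩ := exists_selection_word hnonneg hnozero w j
  have : Nonempty (Fin n) := ⟨j⟩
  obtain ⟨u, hlen, b, hu⟩ := exists_short_synchronizing_word
    (fun q : PositiveSelection A => q.1.2) ⟨v, j, fun i => hv i (hw i)⟩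
  refine ⟨u.map fun q => q.1.1, by simpa using hlen, b, fun i => ?_⟩
  simpa only [hu i] using prod_map_runWord_pos hnonneg u i
end

section
/- Let M = {A_1, ..., A_m} be a finite set of n×n matrices with nonnegative entries and no zero row. Then M is column-primitive if and only if in the digraph of pairs of M, from every node representing a pair of two distinct states there is a directed path to some node representing a single state (a pair {i,i}). -/
open Matrix

/-- The edge relation of the digraph of pairs of the family `A`: there is an edge from the
(unordered) pair `{p.1, p.2}` to `{q.1, q.2}` when some matrix `A k` has positive entries
connecting the two pairs. -/
def PairStep {n m : ℕ} (A : Fin m → Matrix (Fin n) (Fin n) ℝ)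
    (p q : Fin n × Fin n) : Prop :=
  ∃ k, (0 < A k p.1 q.1 ∧ 0 < A k p.2 q.2) ∨ (0 < A k p.1 q.2 ∧ 0 < A k p.2 q.1)

section NonnegMatrix

variable {ι κ : Type*} [Fintype ι]

theorem mul_apply_pos_iff_of_nonneg {B C : Matrix ι ι ℝ} (hB : ∀ i j, 0 ≤ B i j)
    (hC : ∀ i j, 0 ≤ C i j) {i j : ι} :
    0 < (B * C) i j ↔ ∃ l, 0 < B i l ∧ 0 < C l j := by
  rw [Matrix.mul_apply]
  constructor
  · intro h
    obtain ⟨l, -, hl⟩ := Finset.exists_lt_of_sum_lt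
      (s := Finset.univ) (f := fun _ : ι => (0 : ℝ)) (by simpa using h)
    have hBl : B i l ≠ 0 := left_ne_zero_of_mul hl.ne'
    have hCl : C l j ≠ 0 := right_ne_zero_of_mul hl.ne'
    exact ⟨l, (hB i l).lt_of_ne' hBl, (hC l j).lt_of_ne' hCl⟩
  · rintro ⟨l, hBl, hCl⟩
    exact Finset.sum_pos' (fun x _ => mul_nonneg (hB i x) (hC x j))
      ⟨l, Finset.mem_univ l, mul_pos hBl hCl⟩

variable [DecidableEq ι] {A : κ → Matrix ι ι ℝ}

theorem list_prod_apply_nonneg (hA : ∀ k i j, 0 ≤ A k i j) (w : List κ) (i j : ι) :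
    0 ≤ (w.map A).prod i j := by
  induction w generalizing i j with
  | nil =>
    rw [List.map_nil, List.prod_nil, Matrix.one_apply]
    split_ifs <;> norm_num
  | cons k w ih =>
    rw [List.map_cons, List.prod_cons, Matrix.mul_apply]
    exact Finset.sum_nonneg fun l _ => mul_nonneg (hA k i l) (ih l j)

theorem list_prod_cons_apply_pos_iff (hA : ∀ k i j, 0 ≤ A k i j) (k : κ) (w : List κ)
    {i j : ι} :
    0 < ((k :: w).map A).prod i j ↔ ∃ l, 0 < A k i l ∧ 0 < (w.map A).prod l j := by
  rw [List.map_cons, List.prod_cons]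
  exact mul_apply_pos_iff_of_nonneg (hA k) (list_prod_apply_nonneg hA w)

theorem list_prod_append_apply_pos_iff (hA : ∀ k i j, 0 ≤ A k i j) (u w : List κ)
    {i j : ι} :
    0 < ((u ++ w).map A).prod i j ↔
      ∃ l, 0 < (u.map A).prod i l ∧ 0 < (w.map A).prod l j := by
  rw [List.map_append, List.prod_append]
  exact mul_apply_pos_iff_of_nonneg (list_prod_apply_nonneg hA u) (list_prod_apply_nonneg hA w)

theorem exists_list_prod_apply_pos (hA : ∀ k i j, 0 ≤ A k i j)
    (hrow : ∀ k i, ∃ j, 0 < A k i j) (w : List κ) (i : ι) :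
    ∃ j, 0 < (w.map A).prod i j := by
  induction w generalizing i with
  | nil => exact ⟨i, by simp⟩
  | cons k w ih =>
    obtain ⟨l, hl⟩ := hrow k i
    obtain ⟨j, hj⟩ := ih l
    exact ⟨j, (list_prod_cons_apply_pos_iff hA k w).2 ⟨l, hl, hj⟩⟩

/-- If any two states can be sent to a common state by a product of matrices from the family,
then so can any finite set of states. -/
theorem exists_list_prod_pos_on_finset [Nonempty ι] (hA : ∀ k i j, 0 ≤ A k i j)
    (hrow : ∀ k i, ∃ j, 0 < A k i j)
    (hpair : ∀ i₁ i₂, ∃ w : List κ, ∃ j,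
      0 < (w.map A).prod i₁ j ∧ 0 < (w.map A).prod i₂ j) (s : Finset ι) :
    ∃ w : List κ, ∃ j, ∀ i ∈ s, 0 < (w.map A).prod i j := by
  induction s using Finset.induction_on with
  | empty => exact ⟨[], Classical.arbitrary ι, by simp⟩
  | insert a s _ ih =>
    obtain ⟨w, j, hw⟩ := ih
    obtain ⟨l, hl⟩ := exists_list_prod_apply_pos hA hrow w a
    obtain ⟨u, t, hlt, hjt⟩ := hpair l j
    refine ⟨w ++ u, t, fun i hi => (list_prod_append_apply_pos_iff hA w u).2 ?_⟩
    obtain rfl | hi := Finset.mem_insert.1 hi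
    · exact ⟨l, hl, hlt⟩
    · exact ⟨j, hw i hi, hjt⟩

end NonnegMatrix

/-- A path in the digraph of pairs from `p` to the single state `j` exists exactly when some
product of matrices of the family sends both states of `p` to `j`. -/
theorem reflTransGen_pairStep_diag_iff {n m : ℕ} {A : Fin m → Matrix (Fin n) (Fin n) ℝ}
    (hA : ∀ k i j, 0 ≤ A k i j) {p : Fin n × Fin n} {j : Fin n} :
    Relation.ReflTransGen (PairStep A) p (j, j) ↔
      ∃ w : List (Fin m), 0 < (w.map A).prod p.1 j ∧ 0 < (w.map A).prod p.2 j := by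
  constructor
  · intro h
    induction h using Relation.ReflTransGen.head_induction_on with
    | refl => exact ⟨[], by simp⟩
    | head hstep _ ih =>
      obtain ⟨w, h₁, h₂⟩ := ih
      obtain ⟨k, ⟨hk₁, hk₂⟩ | ⟨hk₁, hk₂⟩⟩ := hstep
      · exact ⟨k :: w, (list_prod_cons_apply_pos_iff hA k w).2 ⟨_, hk₁, h₁⟩,
          (list_prod_cons_apply_pos_iff hA k w).2 ⟨_, hk₂, h₂⟩⟩
      · exact ⟨k :: w, (list_prod_cons_apply_pos_iff hA k w).2 ⟨_, hk₁, h₂⟩,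
          (list_prod_cons_apply_pos_iff hA k w).2 ⟨_, hk₂, h₁⟩⟩
  · rintro ⟨w, h₁, h₂⟩
    induction w generalizing p with
    | nil =>
      have eq_of_pos : ∀ i, 0 < (1 : Matrix (Fin n) (Fin n) ℝ) i j → i = j := fun i hi => by
        by_contra hne
        simp [Matrix.one_apply_ne hne] at hi
      rw [show p = (j, j) from Prod.ext (eq_of_pos _ h₁) (eq_of_pos _ h₂)]
    | cons k w ih =>
      obtain ⟨l₁, hk₁, hw₁⟩ := (list_prod_cons_apply_pos_iff hA k w).1 h₁
      obtain ⟨l₂, hk₂, hw₂⟩ := (list_prod_cons_apply_pos_iff hA k w).1 h₂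
      exact .head ⟨k, .inl ⟨hk₁, hk₂⟩⟩ (ih (p := (l₁, l₂)) hw₁ hw₂)

/-- A finite set of nonnegative `n × n` matrices with no zero row is
column-primitive if and only if, in its digraph of pairs, from every node representing a pair
of two distinct states there is a directed path to some node representing a single state. -/
theorem stmt8 (n m : ℕ) (hn : 0 < n)
    (A : Fin m → Matrix (Fin n) (Fin n) ℝ)
    (hnonneg : ∀ k i j, 0 ≤ A k i j)
    (hnozero : ∀ k i, ∃ j, 0 < A k i j) :
    (∃ w : List (Fin m), ∃ j, ∀ i, 0 < (w.map A).prod i j)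
    ↔ (∀ i₁ i₂ : Fin n, i₁ ≠ i₂ →
        ∃ j : Fin n, Relation.ReflTransGen (PairStep A) (i₁, i₂) (j, j)) := by
  constructor
  · rintro ⟨w, j, hw⟩ i₁ i₂ -
    exact ⟨j, (reflTransGen_pairStep_diag_iff hnonneg).2 ⟨w, hw i₁, hw i₂⟩⟩
  · intro h
    have : Nonempty (Fin n) := ⟨⟨0, hn⟩⟩
    obtain ⟨w, j, hw⟩ := exists_list_prod_pos_on_finset hnonneg hnozero (fun i₁ i₂ => by
      obtain rfl | hne := eq_or_ne i₁ i₂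
      · exact ⟨[], i₁, by simp⟩
      · obtain ⟨j, hj⟩ := h i₁ i₂ hne
        obtain ⟨w, hw⟩ := (reflTransGen_pairStep_diag_iff hnonneg).1 hj
        exact ⟨w, j, hw⟩) Finset.univ
    exact ⟨w, j, fun i => hw i (Finset.mem_univ i)⟩
end

section
/- Let M = {A_1, ..., A_m} be a finite set of n×n matrices with nonnegative entries and strictly positive diagonal entries. If M is column-primitive, then M has a positive-column word of length at most n − 1. -/
open Matrix

section PositiveColumn

variable {ι κ : Type*} [Fintype ι] [DecidableEq ι] {A : κ → Matrix ι ι ℝ}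

lemma list_prod_entry_nonneg (hnonneg : ∀ k i j, 0 ≤ A k i j) (w : List κ) (i j : ι) :
    0 ≤ (w.map A).prod i j := by
  induction w generalizing i with
  | nil =>
    rw [List.map_nil, List.prod_nil, Matrix.one_apply]
    split_ifs <;> norm_num
  | cons k w ih =>
    rw [List.map_cons, List.prod_cons, Matrix.mul_apply]
    exact Finset.sum_nonneg fun s _ => mul_nonneg (hnonneg k i s) (ih s)

lemma list_prod_cons_entry_pos (hnonneg : ∀ k i j, 0 ≤ A k i j) {k : κ} {w : List κ} {i s j : ι}
    (hk : 0 < A k i s) (hw : 0 < (w.map A).prod s j) : 0 < ((k :: w).map A).prod i j := by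
  rw [List.map_cons, List.prod_cons, Matrix.mul_apply]
  exact Finset.sum_pos'
    (fun r _ => mul_nonneg (hnonneg k i r) (list_prod_entry_nonneg hnonneg w r j))
    ⟨s, Finset.mem_univ s, mul_pos hk hw⟩

/-- A set containing `j` that is closed under all one-letter transitions contains the support
of the `j`-th column of every product. -/
lemma mem_of_list_prod_entry_pos (hnonneg : ∀ k i j, 0 ≤ A k i j) {S : Finset ι} {j : ι}
    (hj : j ∈ S) (hS : ∀ k i, ∀ s ∈ S, 0 < A k i s → i ∈ S) {w : List κ} {i : ι}
    (hw : 0 < (w.map A).prod i j) : i ∈ S := by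
  induction w generalizing i with
  | nil =>
    rw [List.map_nil, List.prod_nil, Matrix.one_apply] at hw
    split_ifs at hw with h
    · exact h ▸ hj
    · exact absurd hw (lt_irrefl 0)
  | cons k w ih =>
    rw [List.map_cons, List.prod_cons, Matrix.mul_apply] at hw
    obtain ⟨s, -, hs⟩ := Finset.exists_lt_of_sum_lt
      (f := fun _ => (0 : ℝ)) (s := Finset.univ) (by simpa using hw)
    have hs2 : 0 < (w.map A).prod s j := pos_of_mul_pos_right hs (hnonneg k i s)
    exact hS k i s (ih hs2)
      (pos_of_mul_pos_left hs (list_prod_entry_nonneg hnonneg w s j))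

/-- If some product has a positive `j`-th column, then words of length at most `t` suffice for
`min (card ι) (t + 1)` positive entries in that column. -/
lemma exists_word_card_support_ge (hnonneg : ∀ k i j, 0 ≤ A k i j) (hdiag : ∀ k i, 0 < A k i i)
    {w₀ : List κ} {j : ι} (hw₀ : ∀ i, 0 < (w₀.map A).prod i j) (t : ℕ) :
    ∃ w : List κ, w.length ≤ t ∧ 0 < (w.map A).prod j j ∧
      min (Fintype.card ι) (t + 1) ≤
        (Finset.univ.filter fun i => 0 < (w.map A).prod i j).card := by
  induction t with
  | zero =>
    have hone : 0 < (([] : List κ).map A).prod j j := by simp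
    refine ⟨[], le_rfl, hone, (min_le_right _ _).trans ?_⟩
    exact Finset.card_pos.mpr ⟨j, by simp⟩
  | succ t ih =>
    obtain ⟨w, hlen, hjj, hcard⟩ := ih
    set S := Finset.univ.filter fun i => 0 < (w.map A).prod i j with hSdef
    by_cases hS : ∀ k i, ∀ s ∈ S, 0 < A k i s → i ∈ S
    · have huniv : S = Finset.univ := Finset.eq_univ_of_forall fun i =>
        mem_of_list_prod_entry_pos hnonneg (by simpa [hSdef] using hjj) hS (hw₀ i)
      refine ⟨w, by omega, hjj, (min_le_left _ _).trans ?_⟩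
      rw [← hSdef, huniv, Finset.card_univ]
    · push Not at hS
      obtain ⟨k, i, s, hs, hk, hi⟩ := hS
      refine ⟨k :: w, by simpa using hlen,
        list_prod_cons_entry_pos hnonneg (hdiag k j) hjj, ?_⟩
      have hlt : S ⊂ Finset.univ.filter fun i => 0 < ((k :: w).map A).prod i j := by
        refine (Finset.ssubset_iff_of_subset fun r hr => ?_).mpr ⟨i, ?_, hi⟩
        · exact Finset.mem_filter.mpr ⟨Finset.mem_univ r,
            list_prod_cons_entry_pos hnonneg (hdiag k r) (Finset.mem_filter.mp hr).2⟩
        · exact Finset.mem_filter.mpr ⟨Finset.mem_univ i,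
            list_prod_cons_entry_pos hnonneg hk (Finset.mem_filter.mp hs).2⟩
      have := Finset.card_lt_card hlt
      omega

end PositiveColumn

/-- If a finite set of nonnegative `n × n` matrices with strictly positive
diagonal entries is column-primitive, then it has a positive-column word of length at most
`n - 1`. -/
theorem stmt12 (n m : ℕ)
    (A : Fin m → Matrix (Fin n) (Fin n) ℝ)
    (hnonneg : ∀ k i j, 0 ≤ A k i j)
    (hdiag : ∀ k i, 0 < A k i i)
    (hprim : ∃ w : List (Fin m), ∃ j, ∀ i, 0 < (w.map A).prod i j) :
    ∃ w : List (Fin m), w.length ≤ n - 1 ∧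
      ∃ j, ∀ i, 0 < (w.map A).prod i j := by
  obtain ⟨w₀, j, hw₀⟩ := hprim
  obtain ⟨w, hlen, -, hcard⟩ := exists_word_card_support_ge hnonneg hdiag hw₀ (n - 1)
  refine ⟨w, hlen, j, fun i => ?_⟩
  have huniv : (Finset.univ.filter fun i => 0 < (w.map A).prod i j) = Finset.univ := by
    rw [← Finset.card_eq_iff_eq_univ]
    refine le_antisymm (Finset.card_le_univ _) (le_trans ?_ hcard)
    rw [Fintype.card_fin]
    omega
  exact Finset.filter_eq_self.mp huniv i (Finset.mem_univ i)
end

section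
/- Let F be a 3-SAT formula with variables X_1, ..., X_v and clauses C_1, ..., C_c (each clause a disjunction of three literals). Define 2v square matrices of size (1+v+c): for each variable index i and each boolean value b, the matrix A_{i,b} has all diagonal entries equal to 1, entry (1+i, 1) equal to 1, entry (1+v+j, 1) equal to 1 for every clause index j such that assigning X_i the value b satisfies clause C_j, and all other entries equal to 0. Then F is satisfiable if and only if there exists a word of length at most v over this set of 2v matrices whose product has a column all of whose entries are strictly positive. -/
open Matrix

/-- The matrix `A_{X_i = b}` of the reduction from 3-SAT: size `1 + v + c`, ones on the
diagonal, a `1` in position `(1 + i, 1)`, and a `1` in position `(1 + v + j, 1)` for every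
clause `j` satisfied by assigning variable `i` the value `b` (positions are 1-based; the
formula is given by `C`, where clause `j` consists of the three literals `C j s`, a literal
being a pair (variable index, polarity)). -/
def satMatrix (v c : ℕ) (C : Fin c → Fin 3 → Fin v × Bool) (i : Fin v) (b : Bool) :
    Matrix (Fin (1 + v + c)) (Fin (1 + v + c)) ℝ :=
  Matrix.of fun p q =>
    if p = q then 1
    else if (q : ℕ) = 0 ∧
        ((p : ℕ) = 1 + (i : ℕ) ∨
          ∃ j : Fin c, (p : ℕ) = 1 + v + (j : ℕ) ∧ ∃ s : Fin 3, C j s = (i, b))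
      then 1 else 0

/-- The row `p` is marked when variable `x.1` is assigned the value `x.2`: it is either the row of
that variable or the row of a clause satisfied by the assignment. -/
def IsMarked {v c : ℕ} (C : Fin c → Fin 3 → Fin v × Bool) (x : Fin v × Bool) (p : ℕ) : Prop :=
  p = 1 + (x.1 : ℕ) ∨ ∃ j : Fin c, p = 1 + v + (j : ℕ) ∧ ∃ s : Fin 3, C j s = x

lemma IsMarked.pos {v c : ℕ} {C : Fin c → Fin 3 → Fin v × Bool} {x : Fin v × Bool} {p : ℕ}
    (h : IsMarked C x p) : 0 < p := by
  rcases h with h | ⟨j, h, -⟩ <;> omega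

lemma satMatrix_nonneg {v c : ℕ} (C : Fin c → Fin 3 → Fin v × Bool) (x : Fin v × Bool)
    (p q : Fin (1 + v + c)) : 0 ≤ satMatrix v c C x.1 x.2 p q := by
  simp only [satMatrix, Matrix.of_apply]
  split_ifs <;> norm_num

lemma satMatrix_pos_iff {v c : ℕ} (C : Fin c → Fin 3 → Fin v × Bool) (x : Fin v × Bool)
    (p q : Fin (1 + v + c)) :
    0 < satMatrix v c C x.1 x.2 p q ↔ p = q ∨ ((q : ℕ) = 0 ∧ IsMarked C x p) := by
  simp only [satMatrix, Matrix.of_apply, IsMarked]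
  split_ifs <;> simp_all

lemma satMatrix_prod_nonneg {v c : ℕ} (C : Fin c → Fin 3 → Fin v × Bool)
    (w : List (Fin v × Bool)) (p q : Fin (1 + v + c)) :
    0 ≤ (w.map fun x => satMatrix v c C x.1 x.2).prod p q := by
  induction w generalizing p with
  | nil =>
    simp only [List.map_nil, List.prod_nil, Matrix.one_apply]
    split_ifs <;> norm_num
  | cons x w ih =>
    rw [List.map_cons, List.prod_cons, Matrix.mul_apply]
    exact Finset.sum_nonneg fun k _ => mul_nonneg (satMatrix_nonneg C x p k) (ih k)

lemma satMatrix_prod_pos_iff {v c : ℕ} (C : Fin c → Fin 3 → Fin v × Bool)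
    (w : List (Fin v × Bool)) (p q : Fin (1 + v + c)) :
    0 < (w.map fun x => satMatrix v c C x.1 x.2).prod p q ↔
      p = q ∨ ((q : ℕ) = 0 ∧ ∃ x ∈ w, IsMarked C x p) := by
  induction w generalizing p with
  | nil =>
    simp only [List.map_nil, List.prod_nil, Matrix.one_apply]
    split_ifs <;> simp_all
  | cons x w ih =>
    rw [List.map_cons, List.prod_cons, Matrix.mul_apply, Finset.sum_pos_iff_of_nonneg
      fun k _ => mul_nonneg (satMatrix_nonneg C x p k) (satMatrix_prod_nonneg C w k q)]
    have key (k : Fin (1 + v + c)) :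
        0 < satMatrix v c C x.1 x.2 p k * (w.map fun x => satMatrix v c C x.1 x.2).prod k q ↔
          (p = k ∨ ((k : ℕ) = 0 ∧ IsMarked C x p)) ∧
            (k = q ∨ ((q : ℕ) = 0 ∧ ∃ y ∈ w, IsMarked C y k)) := by
      rw [← ih k, ← satMatrix_pos_iff]
      exact ⟨fun h => ⟨pos_of_mul_pos_left h (satMatrix_prod_nonneg C w k q),
        pos_of_mul_pos_right h (satMatrix_nonneg C x p k)⟩, fun h => mul_pos h.1 h.2⟩
    simp only [key, Finset.mem_univ, true_and, List.mem_cons]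
    constructor
    · rintro ⟨k, rfl | ⟨hk, hx⟩, rfl | ⟨hq, y, hy, hyk⟩⟩
      · exact .inl rfl
      · exact .inr ⟨hq, y, .inr hy, hyk⟩
      · exact .inr ⟨hk, x, .inl rfl, hx⟩
      · exact absurd hk hyk.pos.ne'
    · rintro (rfl | ⟨hq, y, rfl | hy, hyp⟩)
      · exact ⟨p, .inl rfl, .inl rfl⟩
      · exact ⟨q, .inr ⟨hq, hyp⟩, .inl rfl⟩
      · exact ⟨p, .inl rfl, .inr ⟨hq, y, hy, hyp⟩⟩

lemma List.nodup_of_forall_mem_of_length_le {α : Type*} [Fintype α] [DecidableEq α] {l : List α}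
    (hmem : ∀ a, a ∈ l) (hlen : l.length ≤ Fintype.card α) : l.Nodup := by
  rw [← Multiset.coe_nodup, ← Multiset.toFinset_card_eq_card_iff_nodup]
  refine le_antisymm (Multiset.toFinset_card_le _) ?_
  have h : (l : Multiset α).toFinset = Finset.univ := by
    ext a
    simp [hmem a]
  rw [h]
  simpa using hlen

/-- A 3-SAT formula with `v` variables and `c` clauses is satisfiable if and
only if the associated set of `2v` matrices of size `1 + v + c` admits a positive-column
product of length at most `v`. -/
theorem stmt14 (v c : ℕ) (C : Fin c → Fin 3 → Fin v × Bool) :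
    (∃ τ : Fin v → Bool, ∀ j : Fin c, ∃ s : Fin 3, τ (C j s).1 = (C j s).2)
    ↔ (∃ w : List (Fin v × Bool), w.length ≤ v ∧
        ∃ q, ∀ p, 0 < ((w.map fun ib => satMatrix v c C ib.1 ib.2).prod) p q) := by
  simp only [satMatrix_prod_pos_iff]
  constructor
  · rintro ⟨τ, hτ⟩
    refine ⟨(List.finRange v).map fun i => (i, τ i), by simp, ⟨0, by omega⟩, fun p => ?_⟩
    have hmem (i : Fin v) : (i, τ i) ∈ (List.finRange v).map fun i => (i, τ i) :=
      List.mem_map_of_mem (List.mem_finRange i)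
    rcases Nat.eq_zero_or_pos (p : ℕ) with hp | hp
    · exact .inl (Fin.ext hp)
    refine .inr ⟨rfl, ?_⟩
    by_cases hpv : (p : ℕ) < 1 + v
    · exact ⟨_, hmem ⟨p - 1, by omega⟩, .inl (by dsimp only; omega)⟩
    · obtain ⟨s, hs⟩ := hτ ⟨p - (1 + v), by omega⟩
      exact ⟨_, hmem _, .inr ⟨_, by dsimp only; omega, s, Prod.ext rfl hs.symm⟩⟩
  · rintro ⟨w, hw, q, hq⟩
    have hq0 : (q : ℕ) = 0 := by
      rcases hq ⟨0, by omega⟩ with h | h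
      · exact (congrArg Fin.val h).symm
      · exact h.1
    have hmark (p : Fin (1 + v + c)) (hp : 0 < (p : ℕ)) : ∃ x ∈ w, IsMarked C x p := by
      rcases hq p with rfl | h
      · omega
      · exact h.2
    have hvar (i : Fin v) : ∃ b, (i, b) ∈ w := by
      obtain ⟨⟨i', b⟩, hx, h | ⟨j, h, -⟩⟩ := hmark ⟨1 + i, by omega⟩ (by dsimp only; omega)
      · obtain rfl : i = i' := Fin.ext (by dsimp only at h; omega)
        exact ⟨b, hx⟩
      · dsimp only at h
        omega
    choose τ hτ using hvar
    have hnodup : (w.map Prod.fst).Nodup :=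
      List.nodup_of_forall_mem_of_length_le (fun i => List.mem_map_of_mem (f := Prod.fst) (hτ i))
        (by simpa using hw)
    refine ⟨τ, fun j => ?_⟩
    obtain ⟨x, hx, h | ⟨j', h, s, rfl⟩⟩ := hmark ⟨1 + v + j, by omega⟩ (by dsimp only; omega)
    · dsimp only at h
      omega
    · obtain rfl : j = j' := Fin.ext (by dsimp only at h; omega)
      exact ⟨s, congrArg Prod.snd (List.inj_on_of_nodup_map hnodup (hτ _) hx rfl)⟩
end
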